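/- (⊢# to ⊢## Theorem) If Γ is an inert typing context, t is a variable or a value, and Γ ⊢# t : T under tight typing, then Γ ⊢## t : T under invertible typing. -/

import Mathlib

/- Variables and labels -/
abbrev Vr := ℕ
abbrev TrmLabel := ℕ
abbrev TypLabel := ℕ

/- Types of the DOT calculus -/
inductive Typ : Type
| top : Typ                          -- ⊤
| bot : Typ                          -- ⊥
| all : Vr → Typ → Typ → Typ         -- ∀(x:S)T
| mu  : Vr → Typ → Typ               -- μ(x:T)
| fld : TrmLabel → Typ → Typ         -- {a : T}
| dec : TypLabel → Typ → Typ → Typ   -- {A : S..T}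
| sel : Vr → TypLabel → Typ          -- x.A
| and : Typ → Typ → Typ              -- S ∧ T
deriving DecidableEq

/- Terms, values, definitions -/
mutual
inductive Trm : Type
| var : Vr → Trm
| val : Vl → Trm
| sel : Vr → TrmLabel → Trm
| app : Vr → Vr → Trm
| lett : Vr → Trm → Trm → Trm
deriving DecidableEq
inductive Vl : Type
| lam : Vr → Typ → Trm → Vl          -- λ(x:T)t
| obj : Vr → Typ → Dfs → Vl          -- ν(x:T)d
deriving DecidableEq
inductive Dfs : Type
| fld : TrmLabel → Trm → Dfs         -- {a = t}
| typ : TypLabel → Typ → Dfs         -- {A = T}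
| and : Dfs → Dfs → Dfs
deriving DecidableEq
end

/- Free variables -/
def Typ.fv : Typ → Finset Vr
| .top => ∅
| .bot => ∅
| .all x S T => S.fv ∪ (T.fv \ {x})
| .mu x T => T.fv \ {x}
| .fld _ T => T.fv
| .dec _ S T => S.fv ∪ T.fv
| .sel x _ => {x}
| .and S T => S.fv ∪ T.fv

mutual
def Trm.fv : Trm → Finset Vr
| .var x => {x}
| .val v => v.fv
| .sel x _ => {x}
| .app x y => {x, y}
| .lett x t u => t.fv ∪ (u.fv \ {x})
def Vl.fv : Vl → Finset Vr
| .lam x T t => T.fv ∪ (t.fv \ {x})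
| .obj x T d => (T.fv ∪ d.fv) \ {x}
def Dfs.fv : Dfs → Finset Vr
| .fld _ t => t.fv
| .typ _ T => T.fv
| .and d₁ d₂ => d₁.fv ∪ d₂.fv
end

/- Substitution of variable y for variable x (capture-avoiding; only
   variable-for-variable substitution is needed in DOT) -/
def Typ.subst (x y : Vr) : Typ → Typ
| .top => .top
| .bot => .bot
| .all z S T => .all z (S.subst x y) (if z = x then T else T.subst x y)
| .mu z T => .mu z (if z = x then T else T.subst x y)
| .fld a T => .fld a (T.subst x y)
| .dec A S T => .dec A (S.subst x y) (T.subst x y)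
| .sel z A => .sel (if z = x then y else z) A
| .and S T => .and (S.subst x y) (T.subst x y)

mutual
def Trm.subst (x y : Vr) : Trm → Trm
| .var z => .var (if z = x then y else z)
| .val v => .val (v.subst x y)
| .sel z a => .sel (if z = x then y else z) a
| .app z w => .app (if z = x then y else z) (if w = x then y else w)
| .lett z t u => .lett z (t.subst x y) (if z = x then u else u.subst x y)
def Vl.subst (x y : Vr) : Vl → Vl
| .lam z T t => .lam z (T.subst x y) (if z = x then t else t.subst x y)
| .obj z T d => .obj z (if z = x then T else T.subst x y) (if z = x then d else d.subst x y)
def Dfs.subst (x y : Vr) : Dfs → Dfs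
| .fld a t => .fld a (t.subst x y)
| .typ A T => .typ A (T.subst x y)
| .and d₁ d₂ => .and (d₁.subst x y) (d₂.subst x y)
end

/- Typing contexts -/
abbrev Ctx := List (Vr × Typ)

def lookupCtx : Ctx → Vr → Option Typ
| [], _ => none
| (y, T) :: Γ, x => if x = y then some T else lookupCtx Γ x

/- Domain (labels) of a collection of definitions -/
def Dfs.dom : Dfs → Finset (TrmLabel ⊕ TypLabel)
| .fld a _ => {Sum.inl a}
| .typ A _ => {Sum.inr A}
| .and d₁ d₂ => d₁.dom ∪ d₂.dom

/- Record types: intersections of field declarations and tight type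
   declarations with pairwise distinct type labels (the Finset collects
   the type labels) -/
inductive RecordTyp : Typ → Finset TypLabel → Prop
| fld : ∀ (a : TrmLabel) (T : Typ), RecordTyp (.fld a T) ∅
| dec : ∀ (A : TypLabel) (T : Typ), RecordTyp (.dec A T T) {A}
| and : ∀ {T U : Typ} {L₁ L₂ : Finset TypLabel},
    RecordTyp T L₁ → RecordTyp U L₂ → Disjoint L₁ L₂ → RecordTyp (.and T U) (L₁ ∪ L₂)

/- Inert types and inert contexts -/
inductive Inert : Typ → Prop
| all : ∀ (x : Vr) (S T : Typ), Inert (.all x S T)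
| mu : ∀ {x : Vr} {T : Typ} {L : Finset TypLabel}, RecordTyp T L → Inert (.mu x T)

def InertCtx (Γ : Ctx) : Prop := ∀ x T, lookupCtx Γ x = some T → Inert T

/- General typing, definition typing and subtyping -/
mutual
inductive HasTyp : Ctx → Trm → Typ → Prop
| var : ∀ {Γ : Ctx} {x : Vr} {T : Typ},
    lookupCtx Γ x = some T → HasTyp Γ (.var x) T
| allI : ∀ {Γ : Ctx} {x : Vr} {T U : Typ} {t : Trm},
    HasTyp ((x, T) :: Γ) t U → x ∉ T.fv →
    HasTyp Γ (.val (.lam x T t)) (.all x T U)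
| allE : ∀ {Γ : Ctx} {x y z : Vr} {S T : Typ},
    HasTyp Γ (.var x) (.all z S T) → HasTyp Γ (.var y) S →
    HasTyp Γ (.app x y) (T.subst z y)
| objI : ∀ {Γ : Ctx} {x : Vr} {T : Typ} {d : Dfs},
    DefTyp ((x, T) :: Γ) d T → HasTyp Γ (.val (.obj x T d)) (.mu x T)
| fldE : ∀ {Γ : Ctx} {x : Vr} {a : TrmLabel} {T : Typ},
    HasTyp Γ (.var x) (.fld a T) → HasTyp Γ (.sel x a) T
| lett : ∀ {Γ : Ctx} {x : Vr} {t u : Trm} {T U : Typ},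
    HasTyp Γ t T → HasTyp ((x, T) :: Γ) u U → x ∉ U.fv →
    HasTyp Γ (.lett x t u) U
| recI : ∀ {Γ : Ctx} {x : Vr} {T : Typ},
    HasTyp Γ (.var x) T → HasTyp Γ (.var x) (.mu x T)
| recE : ∀ {Γ : Ctx} {x z : Vr} {T : Typ},
    HasTyp Γ (.var x) (.mu z T) → HasTyp Γ (.var x) (T.subst z x)
| andI : ∀ {Γ : Ctx} {x : Vr} {T U : Typ},
    HasTyp Γ (.var x) T → HasTyp Γ (.var x) U → HasTyp Γ (.var x) (.and T U)
| sub : ∀ {Γ : Ctx} {t : Trm} {T U : Typ},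
    HasTyp Γ t T → Subtyp Γ T U → HasTyp Γ t U

inductive DefTyp : Ctx → Dfs → Typ → Prop
| fld : ∀ {Γ : Ctx} {a : TrmLabel} {t : Trm} {U : Typ},
    HasTyp Γ t U → DefTyp Γ (.fld a t) (.fld a U)
| typ : ∀ {Γ : Ctx} (A : TypLabel) (T : Typ), DefTyp Γ (.typ A T) (.dec A T T)
| and : ∀ {Γ : Ctx} {d₁ d₂ : Dfs} {T₁ T₂ : Typ},
    DefTyp Γ d₁ T₁ → DefTyp Γ d₂ T₂ → Disjoint d₁.dom d₂.dom →
    DefTyp Γ (.and d₁ d₂) (.and T₁ T₂)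

inductive Subtyp : Ctx → Typ → Typ → Prop
| top : ∀ {Γ : Ctx} {T : Typ}, Subtyp Γ T .top
| bot : ∀ {Γ : Ctx} {T : Typ}, Subtyp Γ .bot T
| refl : ∀ {Γ : Ctx} {T : Typ}, Subtyp Γ T T
| trans : ∀ {Γ : Ctx} {S T U : Typ},
    Subtyp Γ S T → Subtyp Γ T U → Subtyp Γ S U
| and1 : ∀ {Γ : Ctx} {T U : Typ}, Subtyp Γ (.and T U) T
| and2 : ∀ {Γ : Ctx} {T U : Typ}, Subtyp Γ (.and T U) U
| andI : ∀ {Γ : Ctx} {S T U : Typ},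
    Subtyp Γ S T → Subtyp Γ S U → Subtyp Γ S (.and T U)
| fld : ∀ {Γ : Ctx} {a : TrmLabel} {T U : Typ},
    Subtyp Γ T U → Subtyp Γ (.fld a T) (.fld a U)
| typ : ∀ {Γ : Ctx} {A : TypLabel} {S₁ S₂ T₁ T₂ : Typ},
    Subtyp Γ S₂ S₁ → Subtyp Γ T₁ T₂ →
    Subtyp Γ (.dec A S₁ T₁) (.dec A S₂ T₂)
| selLo : ∀ {Γ : Ctx} {x : Vr} {A : TypLabel} {S T : Typ},
    HasTyp Γ (.var x) (.dec A S T) → Subtyp Γ S (.sel x A)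
| selHi : ∀ {Γ : Ctx} {x : Vr} {A : TypLabel} {S T : Typ},
    HasTyp Γ (.var x) (.dec A S T) → Subtyp Γ (.sel x A) T
| all : ∀ {Γ : Ctx} {x : Vr} {S₁ S₂ T₁ T₂ : Typ},
    Subtyp Γ S₂ S₁ → Subtyp ((x, S₂) :: Γ) T₁ T₂ →
    Subtyp Γ (.all x S₁ T₁) (.all x S₂ T₂)
end

/- Precise typing  Γ ⊢! t : T -/
inductive PrecTyp : Ctx → Trm → Typ → Prop
| var : ∀ {Γ : Ctx} {x : Vr} {T : Typ},
    lookupCtx Γ x = some T → PrecTyp Γ (.var x) T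
| recE : ∀ {Γ : Ctx} {x z : Vr} {T : Typ},
    PrecTyp Γ (.var x) (.mu z T) → PrecTyp Γ (.var x) (T.subst z x)
| and1 : ∀ {Γ : Ctx} {x : Vr} {T U : Typ},
    PrecTyp Γ (.var x) (.and T U) → PrecTyp Γ (.var x) T
| and2 : ∀ {Γ : Ctx} {x : Vr} {T U : Typ},
    PrecTyp Γ (.var x) (.and T U) → PrecTyp Γ (.var x) U
| allI : ∀ {Γ : Ctx} {x : Vr} {T U : Typ} {t : Trm},
    HasTyp ((x, T) :: Γ) t U → x ∉ T.fv →
    PrecTyp Γ (.val (.lam x T t)) (.all x T U)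
| objI : ∀ {Γ : Ctx} {x : Vr} {T : Typ} {d : Dfs},
    DefTyp ((x, T) :: Γ) d T → PrecTyp Γ (.val (.obj x T d)) (.mu x T)

/- Tight typing  Γ ⊢# t : T  and tight subtyping  Γ ⊢# S <: U -/
mutual
inductive TightTyp : Ctx → Trm → Typ → Prop
| var : ∀ {Γ : Ctx} {x : Vr} {T : Typ},
    lookupCtx Γ x = some T → TightTyp Γ (.var x) T
| allI : ∀ {Γ : Ctx} {x : Vr} {T U : Typ} {t : Trm},
    HasTyp ((x, T) :: Γ) t U → x ∉ T.fv →
    TightTyp Γ (.val (.lam x T t)) (.all x T U)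
| allE : ∀ {Γ : Ctx} {x y z : Vr} {S T : Typ},
    TightTyp Γ (.var x) (.all z S T) → TightTyp Γ (.var y) S →
    TightTyp Γ (.app x y) (T.subst z y)
| objI : ∀ {Γ : Ctx} {x : Vr} {T : Typ} {d : Dfs},
    DefTyp ((x, T) :: Γ) d T → TightTyp Γ (.val (.obj x T d)) (.mu x T)
| fldE : ∀ {Γ : Ctx} {x : Vr} {a : TrmLabel} {T : Typ},
    TightTyp Γ (.var x) (.fld a T) → TightTyp Γ (.sel x a) T
| lett : ∀ {Γ : Ctx} {x : Vr} {t u : Trm} {T U : Typ},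
    TightTyp Γ t T → HasTyp ((x, T) :: Γ) u U → x ∉ U.fv →
    TightTyp Γ (.lett x t u) U
| recI : ∀ {Γ : Ctx} {x : Vr} {T : Typ},
    TightTyp Γ (.var x) T → TightTyp Γ (.var x) (.mu x T)
| recE : ∀ {Γ : Ctx} {x z : Vr} {T : Typ},
    TightTyp Γ (.var x) (.mu z T) → TightTyp Γ (.var x) (T.subst z x)
| andI : ∀ {Γ : Ctx} {x : Vr} {T U : Typ},
    TightTyp Γ (.var x) T → TightTyp Γ (.var x) U → TightTyp Γ (.var x) (.and T U)
| sub : ∀ {Γ : Ctx} {t : Trm} {T U : Typ},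
    TightTyp Γ t T → TightSub Γ T U → TightTyp Γ t U

inductive TightSub : Ctx → Typ → Typ → Prop
| top : ∀ {Γ : Ctx} {T : Typ}, TightSub Γ T .top
| bot : ∀ {Γ : Ctx} {T : Typ}, TightSub Γ .bot T
| refl : ∀ {Γ : Ctx} {T : Typ}, TightSub Γ T T
| trans : ∀ {Γ : Ctx} {S T U : Typ},
    TightSub Γ S T → TightSub Γ T U → TightSub Γ S U
| and1 : ∀ {Γ : Ctx} {T U : Typ}, TightSub Γ (.and T U) T
| and2 : ∀ {Γ : Ctx} {T U : Typ}, TightSub Γ (.and T U) U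
| andI : ∀ {Γ : Ctx} {S T U : Typ},
    TightSub Γ S T → TightSub Γ S U → TightSub Γ S (.and T U)
| fld : ∀ {Γ : Ctx} {a : TrmLabel} {T U : Typ},
    TightSub Γ T U → TightSub Γ (.fld a T) (.fld a U)
| typ : ∀ {Γ : Ctx} {A : TypLabel} {S₁ S₂ T₁ T₂ : Typ},
    TightSub Γ S₂ S₁ → TightSub Γ T₁ T₂ →
    TightSub Γ (.dec A S₁ T₁) (.dec A S₂ T₂)
| selLo : ∀ {Γ : Ctx} {x : Vr} {A : TypLabel} {T : Typ},
    PrecTyp Γ (.var x) (.dec A T T) → TightSub Γ T (.sel x A)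
| selHi : ∀ {Γ : Ctx} {x : Vr} {A : TypLabel} {T : Typ},
    PrecTyp Γ (.var x) (.dec A T T) → TightSub Γ (.sel x A) T
| all : ∀ {Γ : Ctx} {x : Vr} {S₁ S₂ T₁ T₂ : Typ},
    TightSub Γ S₂ S₁ → Subtyp ((x, S₂) :: Γ) T₁ T₂ →
    TightSub Γ (.all x S₁ T₁) (.all x S₂ T₂)
end

/- Invertible typing  Γ ⊢## t : T  for variables and values -/
inductive InvTyp : Ctx → Trm → Typ → Prop
| var : ∀ {Γ : Ctx} {x : Vr} {T : Typ},
    PrecTyp Γ (.var x) T → InvTyp Γ (.var x) T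
| fld : ∀ {Γ : Ctx} {x : Vr} {a : TrmLabel} {T U : Typ},
    InvTyp Γ (.var x) (.fld a T) → TightSub Γ T U →
    InvTyp Γ (.var x) (.fld a U)
| typ : ∀ {Γ : Ctx} {x : Vr} {A : TypLabel} {T T' U U' : Typ},
    InvTyp Γ (.var x) (.dec A T U) → TightSub Γ T' T → TightSub Γ U U' →
    InvTyp Γ (.var x) (.dec A T' U')
| recI : ∀ {Γ : Ctx} {x : Vr} {T : Typ},
    InvTyp Γ (.var x) T → InvTyp Γ (.var x) (.mu x T)
| allI : ∀ {Γ : Ctx} {x z : Vr} {S S' T T' : Typ},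
    InvTyp Γ (.var x) (.all z S T) → TightSub Γ S' S →
    Subtyp ((z, S') :: Γ) T T' →
    InvTyp Γ (.var x) (.all z S' T')
| andI : ∀ {Γ : Ctx} {x : Vr} {T U : Typ},
    InvTyp Γ (.var x) T → InvTyp Γ (.var x) U → InvTyp Γ (.var x) (.and T U)
| sel : ∀ {Γ : Ctx} {x y : Vr} {A : TypLabel} {S : Typ},
    InvTyp Γ (.var x) S → PrecTyp Γ (.var y) (.dec A S S) →
    InvTyp Γ (.var x) (.sel y A)
| top : ∀ {Γ : Ctx} {x : Vr} {T : Typ},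
    InvTyp Γ (.var x) T → InvTyp Γ (.var x) .top
| val : ∀ {Γ : Ctx} {v : Vl} {T : Typ},
    PrecTyp Γ (.val v) T → InvTyp Γ (.val v) T
| allV : ∀ {Γ : Ctx} {v : Vl} {z : Vr} {S S' T T' : Typ},
    InvTyp Γ (.val v) (.all z S T) → TightSub Γ S' S →
    Subtyp ((z, S') :: Γ) T T' →
    InvTyp Γ (.val v) (.all z S' T')
| andV : ∀ {Γ : Ctx} {v : Vl} {T U : Typ},
    InvTyp Γ (.val v) T → InvTyp Γ (.val v) U → InvTyp Γ (.val v) (.and T U)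
| selV : ∀ {Γ : Ctx} {v : Vl} {y : Vr} {A : TypLabel} {S : Typ},
    InvTyp Γ (.val v) S → PrecTyp Γ (.var y) (.dec A S S) →
    InvTyp Γ (.val v) (.sel y A)
| topV : ∀ {Γ : Ctx} {v : Vl} {T : Typ},
    InvTyp Γ (.val v) T → InvTyp Γ (.val v) .top

/- A definition collection contains the field definition {a = t} -/
inductive DefHasFld : Dfs → TrmLabel → Trm → Prop
| fld : ∀ (a : TrmLabel) (t : Trm), DefHasFld (.fld a t) a t
| andL : ∀ {d₁ : Dfs} {a : TrmLabel} {t : Trm} (d₂ : Dfs),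
    DefHasFld d₁ a t → DefHasFld (.and d₁ d₂) a t
| andR : ∀ {d₂ : Dfs} {a : TrmLabel} {t : Trm} (d₁ : Dfs),
    DefHasFld d₂ a t → DefHasFld (.and d₁ d₂) a t

/- A type (an intersection) contains the field declaration {a : T} -/
inductive TypHasFld : Typ → TrmLabel → Typ → Prop
| fld : ∀ (a : TrmLabel) (T : Typ), TypHasFld (.fld a T) a T
| andL : ∀ {S : Typ} {a : TrmLabel} {T : Typ} (S' : Typ),
    TypHasFld S a T → TypHasFld (.and S S') a T
| andR : ∀ {S' : Typ} {a : TrmLabel} {T : Typ} (S : Typ),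
    TypHasFld S' a T → TypHasFld (.and S S') a T

/- Evaluation contexts  e ::= [] | let x = [] in t | let x = v in e -/
inductive ECtx : Type
| hole : ECtx
| letHole : Vr → Trm → ECtx
| letVal : Vr → Vl → ECtx → ECtx

def ECtx.plug : ECtx → Trm → Trm
| .hole, t => t
| .letHole x u, t => .lett x t u
| .letVal x v e, t => .lett x (.val v) (e.plug t)

/- Small-step operational semantics -/
inductive Red : Trm → Trm → Prop
| apply : ∀ (x y z : Vr) (T : Typ) (t : Trm) (e : ECtx),
    Red (.lett x (.val (.lam z T t)) (ECtx.plug e (.app x y)))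
        (.lett x (.val (.lam z T t)) (ECtx.plug e (t.subst z y)))
| project : ∀ (x : Vr) (T : Typ) (d : Dfs) (a : TrmLabel) (t : Trm) (e : ECtx),
    DefHasFld d a t →
    Red (.lett x (.val (.obj x T d)) (ECtx.plug e (.sel x a)))
        (.lett x (.val (.obj x T d)) (ECtx.plug e t))
| letVar : ∀ (x y : Vr) (t : Trm),
    Red (.lett x (.var y) t) (t.subst x y)
| letLet : ∀ (x y : Vr) (s t u : Trm),
    Red (.lett x (.lett y s t) u) (.lett y s (.lett x t u))
| ctx : ∀ {t t' : Trm} (e : ECtx),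
    Red t t' → Red (ECtx.plug e t) (ECtx.plug e t')

/- Normal forms: variables and values -/
def NormalForm : Trm → Prop
| .var _ => True
| .val _ => True
| _ => False

/- Replacing the binding of x in a context -/
def updateCtx : Ctx → Vr → Typ → Ctx
| [], _, _ => []
| (y, S) :: Γ, x, T => if y = x then (x, T) :: Γ else (y, S) :: updateCtx Γ x T


theorem aux_subst_self (x : Vr) (T : Typ) : T.subst x x = T := by
  induction T with
  | all z S T h1 h2 => simp [Typ.subst, h1, h2]
  | mu z T h => simp [Typ.subst, h]
  | sel z A => by_cases hz : z = x <;> simp [Typ.subst, hz]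
  | _ => simp_all [Typ.subst]

theorem aux_record_subst (x y : Vr) {T : Typ} {L : Finset TypLabel} (h : RecordTyp T L) :
    RecordTyp (T.subst x y) L := by
  induction h with
  | fld a T => exact .fld _ _
  | dec A T => exact .dec _ _
  | and _ _ hd h1 h2 => exact .and h1 h2 hd

def auxHasDec : Typ → TypLabel → Typ → Prop
| .dec A S _, B, U => A = B ∧ S = U
| .and T U, B, V => auxHasDec T B V ∨ auxHasDec U B V
| _, _, _ => False

theorem aux_dec_mem {T : Typ} {L : Finset TypLabel} (h : RecordTyp T L) {A : TypLabel} {S : Typ}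
    (hd : auxHasDec T A S) : A ∈ L := by
  induction h with
  | fld a T => simp [auxHasDec] at hd
  | dec B T => simp [auxHasDec] at hd; simp [hd.1]
  | and _ _ _ h1 h2 =>
    rcases hd with hd | hd
    · exact Finset.mem_union_left _ (h1 hd)
    · exact Finset.mem_union_right _ (h2 hd)

theorem aux_dec_unique {T : Typ} {L : Finset TypLabel} (h : RecordTyp T L) {A : TypLabel}
    {S S' : Typ} (hd : auxHasDec T A S) (hd' : auxHasDec T A S') : S = S' := by
  induction h with
  | fld a T => simp [auxHasDec] at hd
  | dec B T => exact hd.2.symm.trans hd'.2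
  | and r1 r2 hdis h1 h2 =>
    rcases hd with hd | hd <;> rcases hd' with hd' | hd'
    · exact h1 hd hd'
    · exact absurd (aux_dec_mem r2 hd') (Finset.disjoint_left.1 hdis (aux_dec_mem r1 hd))
    · exact absurd (aux_dec_mem r2 hd) (Finset.disjoint_left.1 hdis (aux_dec_mem r1 hd'))
    · exact h2 hd hd'

theorem aux_prec_var {Γ : Ctx} (hΓ : InertCtx Γ) {t : Trm} {T : Typ} (h : PrecTyp Γ t T) :
    ∀ x, t = .var x → (lookupCtx Γ x = some T ∧ Inert T) ∨
      ∃ z R L L', lookupCtx Γ x = some (.mu z R) ∧ RecordTyp (R.subst z x) L ∧ RecordTyp T L' ∧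
        ∀ A S, auxHasDec T A S → auxHasDec (R.subst z x) A S := by
  induction h with
  | var h => rintro x ⟨⟩; exact Or.inl ⟨h, hΓ _ _ h⟩
  | recE h ih =>
    rintro _ ⟨⟩
    rcases ih _ rfl with ⟨hl, hi⟩ | ⟨z, R, L, L', _, _, hr, _⟩
    · cases hi with
      | mu hr =>
        exact Or.inr ⟨_, _, _, _, hl, aux_record_subst _ _ hr, aux_record_subst _ _ hr,
          fun _ _ h => h⟩
    · cases hr
  | and1 h ih =>
    rintro _ ⟨⟩
    rcases ih _ rfl with ⟨hl, hi⟩ | ⟨z, R, L, L', hl, hR, hr, hd⟩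
    · cases hi
    · cases hr with
      | and r1 r2 _ => exact Or.inr ⟨z, R, L, _, hl, hR, r1, fun A S h => hd A S (Or.inl h)⟩
  | and2 h ih =>
    rintro _ ⟨⟩
    rcases ih _ rfl with ⟨hl, hi⟩ | ⟨z, R, L, L', hl, hR, hr, hd⟩
    · cases hi
    · cases hr with
      | and r1 r2 _ => exact Or.inr ⟨z, R, L, _, hl, hR, r2, fun A S h => hd A S (Or.inr h)⟩
  | allI => rintro x ⟨⟩
  | objI => rintro x ⟨⟩

theorem aux_prec_bot {Γ : Ctx} (hΓ : InertCtx Γ) {x : Vr} (h : PrecTyp Γ (.var x) .bot) :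
    False := by
  rcases aux_prec_var hΓ h x rfl with ⟨_, hi⟩ | ⟨_, _, _, _, _, _, hr, _⟩
  · cases hi
  · cases hr

theorem aux_prec_sel {Γ : Ctx} (hΓ : InertCtx Γ) {x y : Vr} {A : TypLabel}
    (h : PrecTyp Γ (.var x) (.sel y A)) : False := by
  rcases aux_prec_var hΓ h x rfl with ⟨_, hi⟩ | ⟨_, _, _, _, _, _, hr, _⟩
  · cases hi
  · cases hr

theorem aux_prec_unique {Γ : Ctx} (hΓ : InertCtx Γ) {x : Vr} {A : TypLabel} {S T : Typ}
    (h : PrecTyp Γ (.var x) (.dec A S S)) (h' : PrecTyp Γ (.var x) (.dec A T T)) : S = T := by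
  rcases aux_prec_var hΓ h x rfl with ⟨_, hi⟩ | ⟨z, R, L, _, hl, hR, _, hd⟩
  · cases hi
  rcases aux_prec_var hΓ h' x rfl with ⟨_, hi⟩ | ⟨z', R', L', _, hl', hR', _, hd'⟩
  · cases hi
  rw [hl] at hl'
  cases hl'
  exact aux_dec_unique hR (hd A S ⟨rfl, rfl⟩) (hd' A T ⟨rfl, rfl⟩)

def AuxNF (t : Trm) : Prop := (∃ x : Vr, t = .var x) ∨ (∃ v : Vl, t = .val v)

theorem aux_inv_sub {Γ : Ctx} {t : Trm} {T U : Typ} (hΓ : InertCtx Γ) (hn : AuxNF t)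
    (hs : TightSub Γ T U) (h : InvTyp Γ t T) : InvTyp Γ t U := by
  match hs with
  | .top =>
    rcases hn with ⟨x, rfl⟩ | ⟨v, rfl⟩
    · exact .top h
    · exact .topV h
  | .bot =>
    cases h with
    | var h => exact (aux_prec_bot hΓ h).elim
    | val h => cases h
  | .refl => exact h
  | .trans h1 h2 => exact aux_inv_sub hΓ hn h2 (aux_inv_sub hΓ hn h1 h)
  | .and1 =>
    cases h with
    | var h => exact .var (.and1 h)
    | andI h1 h2 => exact h1
    | andV h1 h2 => exact h1
    | val h => cases h
  | .and2 =>
    cases h with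
    | var h => exact .var (.and2 h)
    | andI h1 h2 => exact h2
    | andV h1 h2 => exact h2
    | val h => cases h
  | .andI h1 h2 =>
    have k1 := aux_inv_sub hΓ hn h1 h
    have k2 := aux_inv_sub hΓ hn h2 h
    rcases hn with ⟨x, rfl⟩ | ⟨v, rfl⟩
    · exact .andI k1 k2
    · exact .andV k1 k2
  | .fld h1 =>
    rcases hn with ⟨x, rfl⟩ | ⟨v, rfl⟩
    · exact .fld h h1
    · cases h with
      | val h => cases h
  | .typ h1 h2 =>
    rcases hn with ⟨x, rfl⟩ | ⟨v, rfl⟩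
    · exact .typ h h1 h2
    · cases h with
      | val h => cases h
  | .selLo hp =>
    rcases hn with ⟨x, rfl⟩ | ⟨v, rfl⟩
    · exact .sel h hp
    · exact .selV h hp
  | .selHi hp =>
    cases h with
    | var h => exact (aux_prec_sel hΓ h).elim
    | sel h hq => exact aux_prec_unique hΓ hq hp ▸ h
    | selV h hq => exact aux_prec_unique hΓ hq hp ▸ h
    | val h => cases h
  | .all h1 h2 =>
    rcases hn with ⟨x, rfl⟩ | ⟨v, rfl⟩
    · exact .allI h h1 h2
    · exact .allV h h1 h2
termination_by structural hs

theorem aux_main {Γ : Ctx} {t : Trm} {T : Typ} (hΓ : InertCtx Γ) (hn : AuxNF t)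
    (h : TightTyp Γ t T) : InvTyp Γ t T := by
  match h with
  | .var h => exact .var (.var h)
  | .allI h hx => exact .val (.allI h hx)
  | .allE _ _ => rcases hn with ⟨x, h⟩ | ⟨v, h⟩ <;> cases h
  | .objI h => exact .val (.objI h)
  | .fldE _ => rcases hn with ⟨x, h⟩ | ⟨v, h⟩ <;> cases h
  | .lett _ _ _ => rcases hn with ⟨x, h⟩ | ⟨v, h⟩ <;> cases h
  | .recI h => exact .recI (aux_main hΓ hn h)
  | .recE h =>
    have k := aux_main hΓ hn h
    cases k with
    | var h => exact .var (.recE h)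
    | recI h => rw [aux_subst_self]; exact h
  | .andI h1 h2 => exact .andI (aux_main hΓ hn h1) (aux_main hΓ hn h2)
  | .sub h hs => exact aux_inv_sub hΓ hn hs (aux_main hΓ hn h)
termination_by structural h

/- STATEMENT 3: (⊢# to ⊢##) -/
theorem tight_to_invertible (Γ : Ctx) (t : Trm) (T : Typ)
    (hΓ : InertCtx Γ)
    (ht : (∃ x : Vr, t = .var x) ∨ (∃ v : Vl, t = .val v))
    (h : TightTyp Γ t T) : InvTyp Γ t T := by
  exact aux_main hΓ ht h
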